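/- Let n₁, n₂, n₃ ≥ 2 be integers with n₁ odd, and let N = (n₁−1)(n₂−1)(n₃−1)/2. Let T₁ = Σ_{i₁=0}^{n₁} Σ_{i₂=0}^{n₂} Σ_{i₃=0}^{n₃} e_{i₁} ⊗ e_{i₂} ⊗ e_{i₃} ⊗ e_{(i₁,i₂,i₃)} ∈ ℂ^{n₁+1} ⊗ ℂ^{n₂+1} ⊗ ℂ^{n₃+1} ⊗ ℂ^{(n₁+1)(n₂+1)(n₃+1)} and let T₂ = Σ_{j=1}^{N} e_j ⊗ e_j ⊗ e₀ ⊗ e₀ ∈ ℂ^N ⊗ ℂ^N ⊗ ℂ¹ ⊗ ℂ¹. Then R̲(T₁) = (n₁+1)(n₂+1)(n₃+1), R̲(T₂) = N, and R̲(T₁ ⊕ T₂) = (n₁+1)(n₂+1)(n₃+1) + 1. -/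

import Mathlib

open Finset

namespace Subadditivity

noncomputable section

/-- A tensor of order `k` over `ℂ` with `i`-th factor the space `ℂ^{ι i}` of complex-valued
functions on the finite index type `ι i`; the tensor is represented by the array of its
coordinates with respect to the standard basis, i.e. by an element of
`ℂ^{ι 0} ⊗ ⋯ ⊗ ℂ^{ι (k-1)} ≃ ((∀ i, ι i) → ℂ)`. -/
abbrev Tensor {k : ℕ} (ι : Fin k → Type) : Type := (∀ i, ι i) → ℂ

/-- `T` is a sum of `r` simple (rank-one) tensors `v j 0 ⊗ ⋯ ⊗ v j (k-1)`. -/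
def HasRankLE {k : ℕ} {ι : Fin k → Type} (T : Tensor ι) (r : ℕ) : Prop :=
  ∃ v : Fin r → (∀ i, ι i → ℂ), T = fun x => ∑ j : Fin r, ∏ i : Fin k, v j i (x i)

/-- Tensor rank: the least `r` such that `T` is a sum of `r` simple tensors. -/
noncomputable def rank {k : ℕ} {ι : Fin k → Type} (T : Tensor ι) : ℕ :=
  sInf {r | HasRankLE T r}

/-- Border rank is at most `r`: `T` lies in the closure of the set of tensors of rank `≤ r`. -/
def HasBorderRankLE {k : ℕ} {ι : Fin k → Type} (T : Tensor ι) (r : ℕ) : Prop :=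
  T ∈ closure {S : Tensor ι | HasRankLE S r}

/-- Border rank. -/
noncomputable def borderRank {k : ℕ} {ι : Fin k → Type} (T : Tensor ι) : ℕ :=
  sInf {r | HasBorderRankLE T r}

open scoped Classical in
/-- Direct sum of two tensors of order `k`: the coordinates supported on the `ι`-part are
those of `T`, the coordinates supported on the `κ`-part are those of `S`, and all mixed
coordinates vanish. -/
noncomputable def dsum {k : ℕ} {ι κ : Fin k → Type} (T : Tensor ι) (S : Tensor κ) :
    Tensor (fun i => ι i ⊕ κ i) := fun x =>
  (if h : ∃ y : ∀ i, ι i, x = fun i => Sum.inl (y i) then T h.choose else 0) +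
  (if h : ∃ z : ∀ i, κ i, x = fun i => Sum.inr (z i) then S h.choose else 0)

/-- Kronecker product of two tensors of order `k`. -/
def kron {k : ℕ} {ι κ : Fin k → Type} (T : Tensor ι) (S : Tensor κ) :
    Tensor (fun i => ι i × κ i) := fun x =>
  T (fun i => (x i).1) * S (fun i => (x i).2)

/-- `N`-th Kronecker power of a tensor of order `k`. -/
def kpow {k : ℕ} {ι : Fin k → Type} (T : Tensor ι) (N : ℕ) :
    Tensor (fun i => Fin N → ι i) := fun x => ∏ j : Fin N, T (fun i => x i j)

/-- The unit tensor `u_k(r) = Σ_{j=1}^r e_j ⊗ ⋯ ⊗ e_j` of order `k`. -/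
def unit (k r : ℕ) : Tensor (fun _ : Fin k => Fin r) := fun x =>
  ∑ j : Fin r, ∏ i : Fin k, (if x i = j then (1 : ℂ) else 0)

/-- `S` is a degeneration of `T`: `S` lies in the closure of the set of tensors obtained
from `T` by applying linear maps `A i` on each factor. -/
def Degen {k : ℕ} {ι κ : Fin k → Type} [∀ i, Fintype (κ i)]
    (S : Tensor ι) (T : Tensor κ) : Prop :=
  S ∈ closure {S' : Tensor ι | ∃ A : ∀ i, ι i → κ i → ℂ,
    S' = fun x => ∑ y : ∀ i, κ i, (∏ i : Fin k, A i (x i) (y i)) * T y}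

/-- Kronecker delta. -/
def delta {α : Type} [DecidableEq α] (a b : α) : ℂ := if a = b then 1 else 0

/-- The order-4 "spider" tensor
`Σ_{i₁,i₂,i₃} e_{i₁} ⊗ e_{i₂} ⊗ e_{i₃} ⊗ e_{(i₁,i₂,i₃)} ∈ ℂ^{m₁} ⊗ ℂ^{m₂} ⊗ ℂ^{m₃} ⊗ ℂ^{m₁m₂m₃}`,
the last factor being indexed by triples. -/
def spider3 (m₁ m₂ m₃ : ℕ) :
    Tensor ![Fin m₁, Fin m₂, Fin m₃, Fin m₁ × Fin m₂ × Fin m₃] := fun x =>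
  delta (α := Fin m₁ × Fin m₂ × Fin m₃) (x 3) (x 0, x 1, x 2)

/-- The order-4 tensor `Σ_{j=1}^N e_j ⊗ e_j ⊗ e₀ ⊗ e₀ ∈ ℂ^N ⊗ ℂ^N ⊗ ℂ¹ ⊗ ℂ¹`. -/
def matTensor4 (N : ℕ) : Tensor ![Fin N, Fin N, Fin 1, Fin 1] := fun x =>
  delta (α := Fin N) (x 0) (x 1)

/-- The order-4 tensor `Σ_{ℓ=1}^M e_ℓ ⊗ e_ℓ ⊗ e_ℓ ⊗ e₀ ∈ ℂ^M ⊗ ℂ^M ⊗ ℂ^M ⊗ ℂ¹`. -/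
def ghz4 (M : ℕ) : Tensor ![Fin M, Fin M, Fin M, Fin 1] := fun x =>
  delta (α := Fin M) (x 0) (x 1) * delta (α := Fin M) (x 1) (x 2)

/-- The dependent quadruple `(a, b, c, d)`. -/
def quad {ι : Fin 4 → Type*} (a : ι 0) (b : ι 1) (c : ι 2) (d : ι 3) : ∀ i, ι i
  | 0 => a
  | 1 => b
  | 2 => c
  | 3 => d

theorem quad_self {ι : Fin 4 → Type*} (x : ∀ i, ι i) : quad (x 0) (x 1) (x 2) (x 3) = x := by
  funext i
  fin_cases i <;> rfl

theorem dsum_inl {k : ℕ} {ι κ : Fin (k + 1) → Type} (T : Tensor ι) (S : Tensor κ)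
    (y : ∀ i, ι i) : dsum T S (fun i => Sum.inl (y i)) = T y := by
  have h : ∃ y' : ∀ i, ι i, (fun i => (Sum.inl (y i) : ι i ⊕ κ i)) = fun i => Sum.inl (y' i) :=
    ⟨y, rfl⟩
  have h' : ¬ ∃ z : ∀ i, κ i, (fun i => (Sum.inl (y i) : ι i ⊕ κ i)) = fun i => Sum.inr (z i) := by
    rintro ⟨z, hz⟩
    exact Sum.inl_ne_inr (congrFun hz 0)
  have e : h.choose = y := by
    funext i
    exact (Sum.inl_injective (congrFun h.choose_spec i)).symm
  rw [dsum, dif_pos h, dif_neg h', e, add_zero]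

theorem dsum_inr {k : ℕ} {ι κ : Fin (k + 1) → Type} (T : Tensor ι) (S : Tensor κ)
    (z : ∀ i, κ i) : dsum T S (fun i => Sum.inr (z i)) = S z := by
  have h : ∃ z' : ∀ i, κ i, (fun i => (Sum.inr (z i) : ι i ⊕ κ i)) = fun i => Sum.inr (z' i) :=
    ⟨z, rfl⟩
  have h' : ¬ ∃ y : ∀ i, ι i, (fun i => (Sum.inr (z i) : ι i ⊕ κ i)) = fun i => Sum.inl (y i) := by
    rintro ⟨y, hy⟩
    exact Sum.inr_ne_inl (congrFun hy 0)
  have e : h.choose = z := by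
    funext i
    exact (Sum.inr_injective (congrFun h.choose_spec i)).symm
  rw [dsum, dif_neg h', dif_pos h, e, zero_add]

theorem dsum_mixed {k : ℕ} {ι κ : Fin k → Type} (T : Tensor ι) (S : Tensor κ)
    (x : ∀ i, ι i ⊕ κ i) (i j : Fin k) (hi : (x i).isLeft) (hj : (x j).isRight) :
    dsum T S x = 0 := by
  have h : ¬ ∃ y : ∀ i, ι i, x = fun i => Sum.inl (y i) := by
    rintro ⟨y, rfl⟩
    simp at hj
  have h' : ¬ ∃ z : ∀ i, κ i, x = fun i => Sum.inr (z i) := by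
    rintro ⟨z, rfl⟩
    simp at hi
  rw [dsum, dif_neg h, dif_neg h', add_zero]

theorem HasRankLE.of_sum {k : ℕ} {ι : Fin k → Type} {σ : Type*} [Fintype σ] {T : Tensor ι}
    (v : σ → ∀ i, ι i → ℂ) (h : ∀ x, T x = ∑ s, ∏ i, v s i (x i)) {r : ℕ}
    (hr : Fintype.card σ = r) : HasRankLE T r := by
  obtain rfl := hr
  refine ⟨fun j => v ((Fintype.equivFin σ).symm j), funext fun x => ?_⟩
  rw [h]
  exact (Equiv.sum_comp (Fintype.equivFin σ).symm fun s => ∏ i, v s i (x i)).symm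

/-- A flattening of `T` along the factor `i₀` that contains an identity matrix of size `κ`
bounds the border rank from below by `|κ|`. -/
theorem HasBorderRankLE.card_le {k : ℕ} {ι κ} [Fintype κ] [DecidableEq κ] {T : Tensor (k := k) ι}
    {r : ℕ} (hT : HasBorderRankLE T r) (i₀ : Fin k) (f : κ → κ → ∀ i, ι i)
    (hrow : ∀ a b b', f a b i₀ = f a b' i₀) (hcol : ∀ a a' b i, i ≠ i₀ → f a b i = f a' b i)
    (hf : ∀ a b, T (f a b) = if a = b then 1 else 0) : Fintype.card κ ≤ r := by
  by_contra! hlt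
  have hclosed : IsClosed {S : Tensor ι | (Matrix.of fun a b => S (f a b)).det = 0} := by
    refine isClosed_eq ?_ continuous_const
    refine Continuous.matrix_det (continuous_matrix fun a b => ?_)
    exact continuous_apply (f a b)
  have hsub : {S : Tensor ι | HasRankLE S r} ⊆
      {S : Tensor ι | (Matrix.of fun a b => S (f a b)).det = 0} := by
    rintro S ⟨v, rfl⟩
    have hmul : (Matrix.of fun a b => ∑ j : Fin r, ∏ i, v j i (f a b i)) =
        (Matrix.of fun a j => v j i₀ (f a a i₀)) *
          (Matrix.of fun j b => ∏ i ∈ univ.erase i₀, v j i (f b b i)) := by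
      ext a b
      simp only [Matrix.of_apply, Matrix.mul_apply]
      refine sum_congr rfl fun j _ => ?_
      rw [← mul_prod_erase univ _ (mem_univ i₀), hrow a b a]
      congr 1
      refine prod_congr rfl fun i hi => ?_
      rw [hcol a b b i (ne_of_mem_erase hi)]
    simp only [Set.mem_ofPred_eq]
    by_contra hdet
    have hrank := Matrix.rank_of_isUnit _ ((Matrix.isUnit_iff_isUnit_det _).2 (Ne.isUnit hdet))
    rw [hmul] at hrank
    have h1 := Matrix.rank_mul_le_left (Matrix.of fun a j => v j i₀ (f a a i₀))
      (Matrix.of fun j b => ∏ i ∈ univ.erase i₀, v j i (f b b i))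
    have h2 := Matrix.rank_le_card_width (Matrix.of fun a j => v j i₀ (f a a i₀))
    rw [Fintype.card_fin] at h2
    omega
  have hdet : (Matrix.of fun a b => T (f a b)).det = 0 := closure_minimal hsub hclosed hT
  have hone : (Matrix.of fun a b => T (f a b)) = 1 := by
    ext a b
    simp [hf, Matrix.one_apply]
  simp [hone] at hdet

theorem borderRank_eq {k : ℕ} {ι : Fin k → Type} {T : Tensor ι} {r : ℕ}
    (h : HasBorderRankLE T r) (h' : ∀ s, HasBorderRankLE T s → r ≤ s) : borderRank T = r :=
  IsLeast.csInf_eq (s := {r | HasBorderRankLE T r}) ⟨h, h'⟩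

theorem borderRank_spider3 (m₁ m₂ m₃ : ℕ) : borderRank (spider3 m₁ m₂ m₃) = m₁ * m₂ * m₃ := by
  refine borderRank_eq (subset_closure ?_) fun s hs => ?_
  · refine HasRankLE.of_sum (σ := Fin m₁ × Fin m₂ × Fin m₃)
      (fun s => quad (delta (α := Fin m₁) s.1) (delta (α := Fin m₂) s.2.1)
        (delta (α := Fin m₃) s.2.2) (delta (α := Fin m₁ × Fin m₂ × Fin m₃) s)) (fun x => ?_)
      (by simp [mul_assoc])
    rw [← quad_self x]
    generalize x 0 = a, x 1 = b, x 2 = c, x 3 = d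
    change Fin m₁ at a
    change Fin m₂ at b
    change Fin m₃ at c
    change Fin m₁ × Fin m₂ × Fin m₃ at d
    simp only [Fin.prod_univ_four, quad, spider3, delta]
    rw [Fintype.sum_eq_single d fun s hs => by simp [hs]]
    obtain ⟨i, j, k⟩ := d
    simp only [Prod.mk.injEq]
    split_ifs <;> simp_all
  · have := hs.card_le (κ := Fin m₁ × Fin m₂ × Fin m₃) 3
      (fun a b => quad b.1 b.2.1 b.2.2 a) (fun _ _ _ => rfl)
      (fun a a' b i hi => by fin_cases i <;> first | rfl | exact absurd rfl hi)
      (fun a b => by simp [spider3, delta, quad])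
    simpa [mul_assoc] using this

theorem borderRank_matTensor4 (N : ℕ) : borderRank (matTensor4 N) = N := by
  refine borderRank_eq (subset_closure ?_) fun s hs => ?_
  · refine HasRankLE.of_sum (σ := Fin N)
      (fun s => quad (delta (α := Fin N) s) (delta (α := Fin N) s)
        (fun _ => 1) (fun _ => 1)) (fun x => ?_) (by simp)
    rw [← quad_self x]
    generalize x 0 = a, x 1 = b, x 2 = c, x 3 = d
    change Fin N at a
    change Fin N at b
    simp only [Fin.prod_univ_four, quad, matTensor4, delta]
    rw [Fintype.sum_eq_single a fun s hs => by simp [hs]]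
    simp
    rfl
  · have := hs.card_le (κ := Fin N) 0
      (fun a b => quad a b (0 : Fin 1) (0 : Fin 1)) (fun _ _ _ => rfl)
      (fun a a' b i hi => by fin_cases i <;> first | rfl | exact absurd rfl hi)
      (fun a b => by simp [matTensor4, delta, quad]; rfl)
    simpa using this

/-- Coordinates of `spider3 m₁ m₂ m₃ ⊕ matTensor4 N`. -/
def spiderMat (m₁ m₂ m₃ N : ℕ) : Fin m₁ ⊕ Fin N → Fin m₂ ⊕ Fin N → Fin m₃ ⊕ Fin 1 →
    (Fin m₁ × Fin m₂ × Fin m₃) ⊕ Fin 1 → ℂ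
  | .inl a, .inl b, .inl c, .inl d => if d = (a, b, c) then 1 else 0
  | .inr p, .inr q, .inr _, .inr _ => if p = q then 1 else 0
  | _, _, _, _ => 0

theorem dsum_eq_spiderMat (m₁ m₂ m₃ N : ℕ) (a : Fin m₁ ⊕ Fin N) (b : Fin m₂ ⊕ Fin N)
    (c : Fin m₃ ⊕ Fin 1) (d : (Fin m₁ × Fin m₂ × Fin m₃) ⊕ Fin 1) :
    dsum (spider3 m₁ m₂ m₃) (matTensor4 N) (quad a b c d) = spiderMat m₁ m₂ m₃ N a b c d := by
  have hmix (i j : Fin 4) (hi : (quad (ι := fun i => ![Fin m₁, Fin m₂, Fin m₃,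
      Fin m₁ × Fin m₂ × Fin m₃] i ⊕ ![Fin N, Fin N, Fin 1, Fin 1] i) a b c d i).isLeft)
      (hj : (quad (ι := fun i => ![Fin m₁, Fin m₂, Fin m₃,
      Fin m₁ × Fin m₂ × Fin m₃] i ⊕ ![Fin N, Fin N, Fin 1, Fin 1] i) a b c d j).isRight) :=
    dsum_mixed (spider3 m₁ m₂ m₃) (matTensor4 N) _ i j hi hj
  rcases a with a | a <;> rcases b with b | b <;> rcases c with c | c <;> rcases d with d | d <;>
    first
    | exact hmix 0 1 rfl rfl
    | exact hmix 0 2 rfl rfl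
    | exact hmix 0 3 rfl rfl
    | exact hmix 1 0 rfl rfl
    | exact hmix 2 0 rfl rfl
    | exact hmix 3 0 rfl rfl
    | skip
  · refine (congrArg _ ?_).trans (dsum_inl (spider3 m₁ m₂ m₃) (matTensor4 N) (quad a b c d))
    funext i
    fin_cases i <;> rfl
  · refine (congrArg _ ?_).trans (dsum_inr (spider3 m₁ m₂ m₃) (matTensor4 N) (quad a b c d))
    funext i
    fin_cases i <;> rfl

theorem le_of_hasBorderRankLE_dsum {m₁ m₂ m₃ N s : ℕ} (hN : 0 < N)
    (hs : HasBorderRankLE (dsum (spider3 m₁ m₂ m₃) (matTensor4 N)) s) :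
    m₁ * m₂ * m₃ + 1 ≤ s := by
  have := hs.card_le (κ := (Fin m₁ × Fin m₂ × Fin m₃) ⊕ Fin 1) 3
    (fun a b => quad (b.map (fun t => t.1) fun _ => (⟨0, hN⟩ : Fin N))
      (b.map (fun t => t.2.1) fun _ => (⟨0, hN⟩ : Fin N)) (b.map (fun t => t.2.2) id) a)
    (fun _ _ _ => rfl)
    (fun a a' b i hi => by fin_cases i <;> first | rfl | exact absurd rfl hi)
    (fun a b => by
      refine (dsum_eq_spiderMat m₁ m₂ m₃ N _ _ _ _).trans ?_
      rcases a with a | a <;> rcases b with b | b <;>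
        simp [spiderMat, Subsingleton.elim (α := Fin 1) _ 0])
  simpa [mul_assoc] using this

/-- The perturbed basis vector `e_i + t x`. -/
def factor {α β : Type} [DecidableEq α] (t : ℂ) (i : α) (x : β → ℂ) : α ⊕ β → ℂ
  | .inl a => if a = i then 1 else 0
  | .inr p => t * x p

/-- Schönhage-type degeneration: functions `X`, `Y`, `Z` on the grid with vanishing marginals
allow one additional simple tensor to produce the second summand. -/
theorem hasBorderRankLE_dsum {m₁ m₂ m₃ N : ℕ}
    (X Y : Fin m₁ → Fin m₂ → Fin m₃ → Fin N → ℂ) (Z : Fin m₁ → Fin m₂ → Fin m₃ → ℂ)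
    (hX : ∀ j k p, ∑ i, X i j k p = 0) (hY : ∀ i k q, ∑ j, Y i j k q = 0)
    (hZ : ∀ i j, ∑ k, Z i j k = 0)
    (hXY : ∀ k p q, ∑ i, ∑ j, X i j k p * Y i j k q = 0)
    (hXZ : ∀ j p, ∑ i, ∑ k, X i j k p * Z i j k = 0)
    (hYZ : ∀ i q, ∑ j, ∑ k, Y i j k q * Z i j k = 0)
    (hXYZ : ∀ p q, ∑ i, ∑ j, ∑ k, X i j k p * Y i j k q * Z i j k = if p = q then 1 else 0) :
    HasBorderRankLE (dsum (spider3 m₁ m₂ m₃) (matTensor4 N)) (m₁ * m₂ * m₃ + 1) := by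
  let A (t : ℂ) (s : Fin m₁ × Fin m₂ × Fin m₃) := factor t s.1 (X s.1 s.2.1 s.2.2)
  let B (t : ℂ) (s : Fin m₁ × Fin m₂ × Fin m₃) := factor t s.2.1 (Y s.1 s.2.1 s.2.2)
  let C (t : ℂ) (s : Fin m₁ × Fin m₂ × Fin m₃) :=
    factor t s.2.2 (fun _ : Fin 1 => Z s.1 s.2.1 s.2.2)
  let D (t : ℂ) (s : Fin m₁ × Fin m₂ × Fin m₃) :
      (Fin m₁ × Fin m₂ × Fin m₃) ⊕ Fin 1 → ℂ :=
    Sum.elim (fun d => if d = s then 1 else 0) (fun _ => (t ^ 3)⁻¹)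
  let S (t : ℂ) (a : Fin m₁ ⊕ Fin N) (b : Fin m₂ ⊕ Fin N) (c : Fin m₃ ⊕ Fin 1) :
      (Fin m₁ × Fin m₂ × Fin m₃) ⊕ Fin 1 → ℂ
    | .inl s => A t s a * B t s b * C t s c
    | .inr d => spiderMat m₁ m₂ m₃ N a b c (.inr d)
  let E {α β : Type} : α ⊕ β → ℂ := Sum.elim (fun _ => 1) (fun _ => 0)
  have key (t : ℂ) (ht : t ≠ 0) (a b c d) : S t a b c d =
      (∑ s, A t s a * B t s b * C t s c * D t s d) +
        E a * E b * E c * Sum.elim (fun _ => 0) (fun _ => -(t ^ 3)⁻¹) d := by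
    rcases d with d | d
    · simp only [S, D, Sum.elim_inl]
      rw [Fintype.sum_eq_single d fun s hs => by simp [hs.symm]]
      simp
    · simp only [S, D, Sum.elim_inr, Fintype.sum_prod_type]
      rcases a with a | a <;> rcases b with b | b <;> rcases c with c | c
      · simp [A, B, C, E, factor, spiderMat]
      all_goals simp [A, B, C, E, factor, spiderMat]
      all_goals simp [mul_mul_mul_comm _ _ t, ← sum_mul, ← mul_sum, *]
      all_goals field_simp
  have lim (a b c d) : Filter.Tendsto (fun t => S t a b c d) (nhds 0)
      (nhds (spiderMat m₁ m₂ m₃ N a b c d)) := by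
    refine Continuous.tendsto' ?_ _ _ ?_
    · rcases a with a | a <;> rcases b with b | b <;> rcases c with c | c <;>
        rcases d with d | d <;> simp only [S, A, B, C, factor] <;> fun_prop
    · rcases d with d | d
      · rcases a with a | a <;> rcases b with b | b <;> rcases c with c | c <;>
          simp [S, A, B, C, factor, spiderMat]
        grind
      · rfl
  refine mem_closure_of_tendsto (b := nhdsWithin 0 {0}ᶜ)
    (f := fun t x => S t (x 0) (x 1) (x 2) (x 3)) (tendsto_pi_nhds.2 fun x => ?_) ?_
  · have hx := (dsum_eq_spiderMat m₁ m₂ m₃ N (x 0) (x 1) (x 2) (x 3)).symm.trans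
      (congrArg _ (quad_self x))
    exact ((lim (x 0) (x 1) (x 2) (x 3)).mono_right (congrArg nhds hx).le).mono_left
      nhdsWithin_le_nhds
  · filter_upwards [self_mem_nhdsWithin] with t ht
    refine HasRankLE.of_sum (σ := (Fin m₁ × Fin m₂ × Fin m₃) ⊕ Fin 1)
      (Sum.elim (fun s => quad (A t s) (B t s) (C t s) (D t s))
        (fun _ => quad E E E (Sum.elim (fun _ => 0) (fun _ => -(t ^ 3)⁻¹))))
      (fun x => ?_) (by simp [mul_assoc])
    refine (key t ht (x 0) (x 1) (x 2) (x 3)).trans ?_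
    simp only [Fintype.sum_sum_type, Fin.prod_univ_four, Sum.elim_inl, Sum.elim_inr, quad,
      univ_unique, sum_singleton]
    rfl

/-- The case of `hasBorderRankLE_dsum` in which the three functions have product form. -/
theorem hasBorderRankLE_dsum_of_mul {m₁ m₂ m₃ N : ℕ} (a a' : Fin m₁ → Fin N → ℂ)
    (b b' : Fin m₂ → Fin N → ℂ) (c : Fin m₃ → Fin N → ℂ) (u : Fin m₁ → ℂ) (v : Fin m₃ → ℂ)
    (ha : ∀ p, ∑ i, a i p = 0) (hb' : ∀ q, ∑ j, b' j q = 0) (hv : ∑ k, v k = 0)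
    (haa' : ∀ p q, ∑ i, a i p * a' i q = 0) (hau : ∀ p, ∑ i, a i p * u i = 0)
    (h : ∀ p q, (∑ i, a i p * a' i q * u i) * (∑ j, b j p * b' j q) *
      (∑ k, c k p * c k q * v k) = if p = q then 1 else 0) :
    HasBorderRankLE (dsum (spider3 m₁ m₂ m₃) (matTensor4 N)) (m₁ * m₂ * m₃ + 1) := by
  refine hasBorderRankLE_dsum (fun i j k p => a i p * (b j p * c k p))
    (fun i j k q => b' j q * (a' i q * c k q)) (fun i _ k => v k * u i) ?_ ?_ ?_ ?_ ?_ ?_ ?_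
  · intro j k p
    rw [← sum_mul, ha, zero_mul]
  · intro i k q
    rw [← sum_mul, hb', zero_mul]
  · intro i j
    rw [← sum_mul, hv, zero_mul]
  · intro k p q
    rw [sum_comm]
    refine sum_eq_zero fun j _ => ?_
    calc _ = ∑ i, a i p * a' i q * (b j p * c k p * b' j q * c k q) :=
          sum_congr rfl fun i _ => by ring
      _ = 0 := by rw [← sum_mul, haa', zero_mul]
  · intro j p
    rw [sum_comm]
    refine sum_eq_zero fun k _ => ?_
    calc _ = ∑ i, a i p * u i * (b j p * c k p * v k) := sum_congr rfl fun i _ => by ring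
      _ = 0 := by rw [← sum_mul, hau, zero_mul]
  · intro i q
    rw [sum_comm]
    refine sum_eq_zero fun k _ => ?_
    calc _ = ∑ j, b' j q * (a' i q * c k q * (v k * u i)) := sum_congr rfl fun j _ => by ring
      _ = 0 := by rw [← sum_mul, hb', zero_mul]
  · intro p q
    rw [← h p q, sum_mul_sum, sum_mul]
    refine sum_congr rfl fun i _ => ?_
    rw [sum_mul]
    refine sum_congr rfl fun j _ => ?_
    rw [mul_sum]
    exact sum_congr rfl fun k _ => by ring

theorem hasBorderRankLE_dsum_of_le {h n₂ n₃ N : ℕ} (hN : N ≤ h * n₂ * n₃) :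
    HasBorderRankLE (dsum (spider3 (2 * (h + 1)) (n₂ + 1) (n₃ + 1)) (matTensor4 N))
      (2 * (h + 1) * (n₂ + 1) * (n₃ + 1) + 1) := by
  obtain ⟨f⟩ : Nonempty (Fin N ↪ Fin h × Fin n₂ × Fin n₃) :=
    Function.Embedding.nonempty_of_card_le (by simpa [← mul_assoc] using hN)
  let e : Fin (2 * (h + 1)) ≃ Fin 2 × Fin (h + 1) := finProdFinEquiv.symm
  let σ : Fin 2 → ℂ := ![1, -1]
  let d {n : ℕ} (j : Fin (n + 1)) (p : Fin n) : ℂ := if j = p.castSucc then 1 else 0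
  let w {n : ℕ} (j : Fin (n + 1)) (p : Fin n) : ℂ := d j p - if j = Fin.last n then 1 else 0
  have hw {n : ℕ} (p : Fin n) : ∑ j, w j p = 0 := by simp [w, d]
  have hwd {n : ℕ} (p q : Fin n) : ∑ j, w j p * d j q = if p = q then 1 else 0 := by
    simp [w, d, eq_comm]
  refine hasBorderRankLE_dsum_of_mul
    (fun i p => w (e i).2 (f p).1) (fun i p => σ (e i).1 * d (e i).2 (f p).1)
    (fun j p => d j (f p).2.1) (fun j p => w j (f p).2.1) (fun k p => d k (f p).2.2)
    (fun i => σ (e i).1 / 2) (fun k => if k = Fin.last n₃ then -n₃ else 1) ?_ ?_ ?_ ?_ ?_ ?_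
  · intro p
    rw [e.sum_comp fun s => w s.2 (f p).1, Fintype.sum_prod_type]
    simp [hw]
  · intro q
    exact hw _
  · simp [Fin.sum_univ_castSucc]
  · intro p q
    rw [e.sum_comp fun s => w s.2 (f p).1 * (σ s.1 * d s.2 (f q).1), Fintype.sum_prod_type]
    simp [σ]
  · intro p
    rw [e.sum_comp fun s => w s.2 (f p).1 * (σ s.1 / 2), Fintype.sum_prod_type]
    simp [σ, ← sum_mul, hw]
  · intro p q
    rw [e.sum_comp fun s => w s.2 (f p).1 * (σ s.1 * d s.2 (f q).1) * (σ s.1 / 2),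
      Fintype.sum_prod_type]
    have h₁ : ∑ s, ∑ i, w i (f p).1 * (σ s * d i (f q).1) * (σ s / 2) =
        if (f p).1 = (f q).1 then 1 else 0 := by
      rw [← hwd, Fin.sum_univ_two, ← sum_add_distrib]
      exact sum_congr rfl fun i _ => by simp [σ]; ring
    have h₂ : ∑ j, d j (f p).2.1 * w j (f q).2.1 = if (f p).2.1 = (f q).2.1 then 1 else 0 := by
      simp_rw [mul_comm (d _ _), hwd, eq_comm]
    have h₃ : ∑ k, d k (f p).2.2 * d k (f q).2.2 * (if k = Fin.last n₃ then -n₃ else 1 : ℂ) =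
        if (f p).2.2 = (f q).2.2 then 1 else 0 := by
      simp [d, Fin.sum_univ_castSucc, (Fin.castSucc_lt_last _).ne', eq_comm]
    rw [h₁, h₂, h₃]
    simp only [← f.injective.eq_iff (a := p), Prod.ext_iff]
    split_ifs <;> simp_all

/-- Theorem: Construction 1, adding a matrix. For `n₁, n₂, n₃ ≥ 2` with
`n₁` odd and `N = (n₁−1)(n₂−1)(n₃−1)/2`:
`R̲(T₁) = (n₁+1)(n₂+1)(n₃+1)`, `R̲(T₂) = N`, and
`R̲(T₁ ⊕ T₂) = (n₁+1)(n₂+1)(n₃+1) + 1`. -/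
theorem construction1 (n₁ n₂ n₃ N : ℕ) (h₁ : 2 ≤ n₁) (h₂ : 2 ≤ n₂) (h₃ : 2 ≤ n₃)
    (hodd : Odd n₁) (hN : N = (n₁ - 1) * (n₂ - 1) * (n₃ - 1) / 2) :
    borderRank (spider3 (n₁ + 1) (n₂ + 1) (n₃ + 1)) = (n₁ + 1) * (n₂ + 1) * (n₃ + 1) ∧
    borderRank (matTensor4 N) = N ∧
    borderRank (dsum (spider3 (n₁ + 1) (n₂ + 1) (n₃ + 1)) (matTensor4 N)) =
      (n₁ + 1) * (n₂ + 1) * (n₃ + 1) + 1 := by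
  refine ⟨borderRank_spider3 _ _ _, borderRank_matTensor4 N,
    borderRank_eq ?_ fun s hs => le_of_hasBorderRankLE_dsum ?_ hs⟩
  · obtain ⟨h, rfl⟩ := hodd
    refine hasBorderRankLE_dsum_of_le (h := h) ?_
    rw [hN, Nat.add_sub_cancel, mul_assoc, mul_assoc, Nat.mul_div_cancel_left _ two_pos, mul_assoc]
    gcongr <;> omega
  · obtain ⟨h, rfl⟩ := hodd
    rw [hN, Nat.add_sub_cancel, mul_assoc, mul_assoc, Nat.mul_div_cancel_left _ two_pos]
    have : 0 < h := by omega
    have : 0 < n₂ - 1 := by omega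
    have : 0 < n₃ - 1 := by omega
    positivity

end
end Subadditivity
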